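/- Factorization of the two-mode Fisher-difference sum (core of the optical phase-sensing theorem): let 0 < r < 1, let g_m := (1−r)·r^m for m ∈ ℕ be the geometric distribution, and let p be a probability distribution on ℕ with finite mean. Then ∑_{n≥1, m≥0} f(p_n·g_m, p_{n−1}·g_{m+1})·n·(m+1) = (1/(1−r)) · ∑_{n=1}^∞ f(p_n, r·p_{n−1})·n. -/

import Mathlib

/-- The Fisher difference `f(x,y) = (x-y)^2/(x+y)`, with `f(0,0) = 0`
(automatic since division by zero is zero in Lean). -/
noncomputable def fisherDiff (x y : ℝ) : ℝ := (x - y) ^ 2 / (x + y)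

theorem fisherDiff_nonneg {x y : ℝ} (hx : 0 ≤ x) (hy : 0 ≤ y) : 0 ≤ fisherDiff x y := by
  unfold fisherDiff
  positivity

theorem fisherDiff_le_add {x y : ℝ} (hx : 0 ≤ x) (hy : 0 ≤ y) : fisherDiff x y ≤ x + y := by
  unfold fisherDiff
  refine div_le_of_le_mul₀ (by positivity) (by positivity) ?_
  nlinarith [mul_nonneg hx hy]

theorem fisherDiff_mul_left (c x y : ℝ) : fisherDiff (c * x) (c * y) = c * fisherDiff x y := by
  unfold fisherDiff
  rcases eq_or_ne c 0 with rfl | hc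
  · simp
  · rw [← mul_sub, ← mul_add, mul_pow, sq c, mul_assoc, mul_div_mul_left _ _ hc, mul_div_assoc]

theorem hasSum_succ_mul_geometric {r : ℝ} (hr : |r| < 1) :
    HasSum (fun m : ℕ => (m + 1 : ℝ) * r ^ m) (1 / (1 - r) ^ 2) := by
  simpa using hasSum_choose_mul_geometric_of_norm_lt_one 1 (r := r) hr

theorem summable_fisherDiff_mul_succ {r : ℝ} (hr : 0 ≤ r) {p : ℕ → ℝ} (hp : ∀ n, 0 ≤ p n)
    (hsum : Summable p) (hmean : Summable fun n : ℕ => (n : ℝ) * p n) :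
    Summable fun n : ℕ => fisherDiff (p (n + 1)) (r * p n) * (n + 1 : ℝ) := by
  have hbound : Summable fun n : ℕ =>
      ((n + 1 : ℕ) : ℝ) * p (n + 1) + r * ((n : ℝ) * p n + p n) :=
    ((summable_nat_add_iff 1).2 hmean).add ((hmean.add hsum).mul_left r)
  refine hbound.of_nonneg_of_le (fun n => ?_) fun n => ?_
  · exact mul_nonneg (fisherDiff_nonneg (hp _) (mul_nonneg hr (hp _))) (by positivity)
  · calc fisherDiff (p (n + 1)) (r * p n) * (n + 1 : ℝ)
        ≤ (p (n + 1) + r * p n) * (n + 1 : ℝ) := by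
          gcongr
          exact fisherDiff_le_add (hp _) (mul_nonneg hr (hp _))
      _ = _ := by push_cast; ring

/-- Factorization of the two-mode Fisher-difference sum: interfering a
phase-invariant state `p` with the geometric (thermal) distribution `g`. -/
theorem two_mode_fisher_sum_factorization (r : ℝ) (hr0 : 0 < r) (hr1 : r < 1)
    (p : ℕ → ℝ) (hp : ∀ n, 0 ≤ p n) (hp1 : ∑' n : ℕ, p n = 1)
    (hmean : Summable fun n : ℕ => (n : ℝ) * p n) :
    (∑' nm : ℕ × ℕ,
        fisherDiff (p (nm.1 + 1) * ((1 - r) * r ^ nm.2))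
            (p nm.1 * ((1 - r) * r ^ (nm.2 + 1))) *
          (nm.1 + 1 : ℝ) * (nm.2 + 1 : ℝ)) =
      (1 / (1 - r)) * ∑' n : ℕ, fisherDiff (p (n + 1)) (r * p n) * (n + 1 : ℝ) := by
  have hsum : Summable p := by
    by_contra h
    simp [tsum_eq_zero_of_not_summable h] at hp1
  have hr : |r| < 1 := by rwa [abs_of_pos hr0]
  have hgeom := (hasSum_succ_mul_geometric hr).mul_left (1 - r)
  have hfisher := summable_fisherDiff_mul_succ hr0.le hp hsum hmean
  have hconst : (1 - r) * (1 / (1 - r) ^ 2) = 1 / (1 - r) := by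
    have : 1 - r ≠ 0 := (sub_pos.2 hr1).ne'
    field_simp
  rw [← hconst, ← hgeom.tsum_eq, mul_comm,
    tsum_mul_tsum_of_summable_norm hfisher.norm hgeom.summable.norm]
  refine tsum_congr fun nm => ?_
  have hscale : fisherDiff (p (nm.1 + 1) * ((1 - r) * r ^ nm.2))
      (p nm.1 * ((1 - r) * r ^ (nm.2 + 1))) =
      ((1 - r) * r ^ nm.2) * fisherDiff (p (nm.1 + 1)) (r * p nm.1) := by
    rw [← fisherDiff_mul_left]
    congr 1 <;> ring
  rw [hscale]
  ring
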